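/- Let A be a real m×n matrix with n ≥ 1, let K(A) = {x ∈ ℝ^n : x ≥ 0 coordinatewise and Ax = 0}, and suppose K(A) contains a vector with all coordinates strictly positive. Let m' = dim span K(A). Then there exist m' linearly independent extremal elements v₁, …, v_{m'} of K(A) such that for every coordinate index i ∈ {1,…,n} there is some j with (v_j)_i > 0; equivalently, v₁ + ⋯ + v_{m'} has all coordinates strictly positive. -/

import Mathlib

/-- The cone `K(A) = {x ∈ ℝ^n : x ≥ 0 coordinatewise and A x = 0}`. -/
def nonnegKernel {m n : ℕ} (A : Matrix (Fin m) (Fin n) ℝ) : Set (Fin n → ℝ) :=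
  {x | (∀ i, 0 ≤ x i) ∧ A.mulVec x = 0}

/-- `v` is an extremal element of the cone `K(A)`: it is nonzero and any decomposition
`v = v₁ + v₂` with `v₁, v₂ ∈ K(A)` has both summands nonnegative multiples of `v`. -/
def IsExtremalIn {m n : ℕ} (A : Matrix (Fin m) (Fin n) ℝ) (v : Fin n → ℝ) : Prop :=
  v ∈ nonnegKernel A ∧ v ≠ 0 ∧
    ∀ v₁ ∈ nonnegKernel A, ∀ v₂ ∈ nonnegKernel A, v = v₁ + v₂ →
      (∃ c : ℝ, 0 ≤ c ∧ v₁ = c • v) ∧ (∃ c : ℝ, 0 ≤ c ∧ v₂ = c • v)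

theorem nk_aux {m n : ℕ} (A : Matrix (Fin m) (Fin n) ℝ) (a b : Fin n → ℝ)
    (ha : a ∈ nonnegKernel A) (hb : b ∈ nonnegKernel A) (hb0 : b ≠ 0) :
    ∃ t : ℝ, 0 ≤ t ∧ a - t • b ∈ nonnegKernel A ∧ ∃ i, b i ≠ 0 ∧ (a - t • b) i = 0 := by
  classical
  obtain ⟨i0, hi0⟩ := Function.ne_iff.mp hb0
  obtain ⟨i, hi, hmin⟩ := Finset.exists_min_image (Finset.univ.filter (fun i => b i ≠ 0))
    (fun i => a i / b i) ⟨i0, by simpa using hi0⟩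
  have hbi : b i ≠ 0 := by simpa using hi
  refine ⟨a i / b i, div_nonneg (ha.1 i) (hb.1 i), ⟨fun j => ?_, ?_⟩, i, hbi, ?_⟩
  · by_cases hj : b j = 0
    · simpa [hj] using ha.1 j
    · have h := hmin j (by simpa using hj)
      have hbj : 0 < b j := lt_of_le_of_ne (hb.1 j) (Ne.symm hj)
      have := (le_div_iff₀ hbj).mp h
      simpa using this
  · rw [Matrix.mulVec_sub, Matrix.mulVec_smul, ha.2, hb.2]; simp
  · simp [hbi]

theorem nk_nonneg_mul {m n : ℕ} (A : Matrix (Fin m) (Fin n) ℝ) (x : Fin n → ℝ)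
    (H : ∀ y ∈ nonnegKernel A, (∀ i, x i = 0 → y i = 0) → (∃ i, x i ≠ 0 ∧ y i = 0) →
      y ∈ Submodule.span ℝ {v | IsExtremalIn A v})
    (hx : x ∈ nonnegKernel A) (hx0 : x ≠ 0)
    (hs : x ∉ Submodule.span ℝ {v | IsExtremalIn A v})
    (u : Fin n → ℝ) (hu : u ∈ nonnegKernel A) (hux : ∀ i, x i = 0 → u i = 0) :
    ∃ c : ℝ, 0 ≤ c ∧ u = c • x := by
  by_cases hu0 : u = 0
  · exact ⟨0, le_rfl, by simp [hu0]⟩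
  obtain ⟨t, ht, hy, i, hi, hyi⟩ := nk_aux A x u hx hu hu0
  obtain ⟨s, hs0, hz, k, hk, hzk⟩ := nk_aux A u x hu hx hx0
  have h1 := H _ hy (fun j hj => by simp [hj, hux j hj]) ⟨i, fun h => hi (hux i h), hyi⟩
  have h2 := H _ hz (fun j hj => by simp [hj, hux j hj]) ⟨k, hk, hzk⟩
  have h3 := Submodule.add_mem _ h1 (Submodule.smul_mem _ t h2)
  have h4 : x - t • u + t • (u - s • x) = (1 - t * s) • x := by module
  rw [h4] at h3
  by_cases hts : 1 - t * s = 0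
  · refine ⟨s, hs0, funext fun j => ?_⟩
    have e := congrFun h4 j
    have a1 := hy.1 j
    have a2 := hz.1 j
    have t0 : 0 < t := lt_of_le_of_ne ht (by rintro rfl; simp at hts)
    simp [hts] at e a1 a2 ⊢
    nlinarith
  · exact absurd ((Submodule.smul_mem_iff _ hts).mp h3) hs

theorem nk_span {m n : ℕ} (A : Matrix (Fin m) (Fin n) ℝ) (N : ℕ) : ∀ x ∈ nonnegKernel A,
    (Finset.univ.filter (fun i => x i ≠ 0)).card ≤ N →
    x ∈ Submodule.span ℝ {v | IsExtremalIn A v} := by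
  induction N using Nat.strong_induction_on with
  | _ N ih =>
  intro x hx hN
  by_contra hs
  have hx0 : x ≠ 0 := by rintro rfl; exact hs (Submodule.zero_mem _)
  have key := nk_nonneg_mul A x (fun y hy h1 h2 => by
    refine ih _ (lt_of_lt_of_le (Finset.card_lt_card ?_) hN) y hy le_rfl
    obtain ⟨i, hi, hyi⟩ := h2
    rw [Finset.ssubset_iff_of_subset]
    · exact ⟨i, by simpa using hi, by simpa using hyi⟩
    · intro j hj
      simp only [Finset.mem_filter, Finset.mem_univ, true_and] at hj ⊢
      exact fun h => hj (h1 j h)) hx hx0 hs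
  apply hs
  apply Submodule.subset_span
  refine ⟨hx, hx0, fun v₁ h₁ v₂ h₂ e => ⟨key v₁ h₁ fun i hi => ?_, key v₂ h₂ fun i hi => ?_⟩⟩ <;>
  · have e' := congrFun e i
    have := h₁.1 i
    have := h₂.1 i
    simp only [Pi.add_apply] at e'
    linarith

/-- if `K(A)` contains a strictly positive vector and `m'` is the dimension of
the span of `K(A)`, then there are `m'` linearly independent extremal elements of `K(A)`
such that every coordinate index is in the support of one of them. -/
theorem statement_12 {m n : ℕ} (hn : 1 ≤ n) (A : Matrix (Fin m) (Fin n) ℝ)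
    (hpos : ∃ ω ∈ nonnegKernel A, ∀ i, 0 < ω i) :
    ∃ v : Fin (Module.finrank ℝ (Submodule.span ℝ (nonnegKernel A))) → (Fin n → ℝ),
      LinearIndependent ℝ v ∧ (∀ j, IsExtremalIn A (v j)) ∧ ∀ i, ∃ j, 0 < v j i := by
  have hspan : Submodule.span ℝ (nonnegKernel A) = Submodule.span ℝ {v | IsExtremalIn A v} :=
    le_antisymm (Submodule.span_le.mpr fun x hx => nk_span A _ x hx le_rfl)
      (Submodule.span_mono fun v hv => hv.1)
  obtain ⟨b, hb, hbs, hli⟩ := exists_linearIndependent ℝ {v | IsExtremalIn A v}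
  have hfin : Finite b := hli.finite
  have : Fintype b := Fintype.ofFinite b
  have hcard : Fintype.card b = Module.finrank ℝ (Submodule.span ℝ (nonnegKernel A)) := by
    rw [hspan, ← hbs]
    have := finrank_span_eq_card hli
    rw [Subtype.range_coe] at this
    exact this.symm
  let e := (Fintype.equivFinOfCardEq hcard).symm
  refine ⟨fun j => (e j : Fin n → ℝ), hli.comp e e.injective, fun j => hb (e j).2, fun i => ?_⟩
  by_contra hcon
  push Not at hcon
  obtain ⟨ω, hω, hωp⟩ := hpos
  have hle : Submodule.span ℝ b ≤ LinearMap.ker (LinearMap.proj (R := ℝ) (φ := fun _ => ℝ) i) := by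
    refine Submodule.span_le.mpr fun v hv => ?_
    have h1 := hcon (e.symm ⟨v, hv⟩)
    have h2 := (hb hv).1.1 i
    simp only [Equiv.apply_symm_apply] at h1
    simpa using le_antisymm h1 h2
  have hmem : ω ∈ Submodule.span ℝ b := by
    rw [hbs, ← hspan]; exact Submodule.subset_span hω
  have := hle hmem
  simp at this
  exact (hωp i).ne' this
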